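/- Series expansion of the sphere integral: for x, y ∈ ℝ^{d+1}, ∫_{S^d(1)} exp(∑_{i=1}^{d+1}(x_i t_i² + y_i t_i)) |dt| = S_d · ∑_{α,β ∈ ℕ^{d+1}} ((d−1)!! ∏_{i}(2α_i+2β_i−1)!!)/((d−1+2|α|+2|β|)!! α! (2β)!) x^α y^{2β}, where S_d = ∫_{S^d(1)} |dt| is the surface area of the unit d-sphere. -/

import Mathlib

open MeasureTheory

/-- The restricted Fisher–Bingham normalizing constant. -/
noncomputable def Ztilde (d : ℕ) (x y : Fin (d + 1) → ℝ) (r : ℝ) : ℝ :=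
  ∫ t in Metric.sphere (0 : EuclideanSpace ℝ (Fin (d + 1))) r,
    Real.exp (∑ i, (x i * t i ^ 2 + y i * t i)) ∂(μH[(d : ℝ)])

/-- The surface area of the unit `d`-sphere in `ℝ^{d+1}`. -/
noncomputable def sphereArea (d : ℕ) : ℝ :=
  (μH[(d : ℝ)] (Metric.sphere (0 : EuclideanSpace ℝ (Fin (d + 1))) 1)).toReal

lemma pi_series (n : ℕ) (f : Fin n → ℕ → ℝ) (hf : ∀ i, Summable fun k => ‖f i k‖) :
    (Summable fun a : Fin n → ℕ => ‖∏ i, f i (a i)‖) ∧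
      ∑' a : Fin n → ℕ, ∏ i, f i (a i) = ∏ i, ∑' k, f i k := by
  induction n with
  | zero =>
    refine ⟨(hasSum_fintype _).summable, ?_⟩
    simp
  | succ n ih =>
    obtain ⟨h1, h2⟩ := ih (fun i => f i.succ) (fun i => hf i.succ)
    constructor
    · rw [← (Fin.consEquiv (fun _ : Fin (n + 1) => ℕ)).summable_iff]
      have := (hf 0).mul_norm h1
      refine this.congr ?_
      intro p
      simp [Fin.prod_univ_succ]
    · rw [← (Fin.consEquiv (fun _ : Fin (n + 1) => ℕ)).tsum_eq, Fin.prod_univ_succ, ← h2,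
        tsum_mul_tsum_of_summable_norm (hf 0) h1]
      refine tsum_congr ?_
      intro p
      simp [Fin.prod_univ_succ]

lemma exp_pi_series (n : ℕ) (z : Fin n → ℝ) :
    (Summable fun a : Fin n → ℕ => ‖∏ i, (z i ^ a i / (Nat.factorial (a i) : ℝ))‖) ∧
      ∑' a : Fin n → ℕ, ∏ i, (z i ^ a i / (Nat.factorial (a i) : ℝ)) = Real.exp (∑ i, z i) := by
  obtain ⟨h1, h2⟩ := pi_series n (fun i k => z i ^ k / (Nat.factorial k : ℝ))
    (fun i => (Real.summable_pow_div_factorial (z i)).norm)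
  refine ⟨h1, h2.trans ?_⟩
  rw [Real.exp_sum]
  refine Finset.prod_congr rfl fun i _ => ?_
  rw [Real.exp_eq_exp_ℝ, (NormedSpace.expSeries_div_hasSum_exp (z i)).tsum_eq]

lemma exp_pi_series2 (n : ℕ) (z w : Fin n → ℝ) :
    HasSum (fun p : (Fin n → ℕ) × (Fin n → ℕ) =>
      (∏ i, (z i ^ p.1 i / (Nat.factorial (p.1 i) : ℝ))) *
        ∏ i, (w i ^ p.2 i / (Nat.factorial (p.2 i) : ℝ)))
      (Real.exp (∑ i, (z i + w i))) := by
  obtain ⟨h1, h2⟩ := exp_pi_series n z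
  obtain ⟨h3, h4⟩ := exp_pi_series n w
  rw [Finset.sum_add_distrib, Real.exp_add, ← h2, ← h4, tsum_mul_tsum_of_summable_norm h1 h3]
  exact (summable_mul_of_summable_norm h1 h3).hasSum

section Rot
variable {n : ℕ}

/-- Rotation in the plane of coordinates `i`, `j`, as a linear map. -/
noncomputable def rotLin (i j : Fin n) (θ : ℝ) :
    EuclideanSpace ℝ (Fin n) →ₗ[ℝ] EuclideanSpace ℝ (Fin n) where
  toFun t := WithLp.toLp 2 fun k =>
    if k = i then Real.cos θ * t i - Real.sin θ * t j
    else if k = j then Real.sin θ * t i + Real.cos θ * t j else t k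
  map_add' s t := by
    ext k
    simp only [PiLp.add_apply]
    split_ifs <;> ring
  map_smul' c t := by
    ext k
    simp only [PiLp.smul_apply, smul_eq_mul, RingHom.id_apply]
    split_ifs <;> ring

lemma prod_split {M : Type*} [CommMonoid M] {i j : Fin n} (hij : i ≠ j) (f : Fin n → M) :
    ∏ k, f k = f i * (f j * ∏ k ∈ (Finset.univ.erase i).erase j, f k) := by
  rw [Finset.mul_prod_erase _ _ (by simp [hij.symm]), Finset.mul_prod_erase _ _ (by simp)]

lemma sum_split {i j : Fin n} (hij : i ≠ j) (f : Fin n → ℝ) :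
    ∑ k, f k = f i + (f j + ∑ k ∈ (Finset.univ.erase i).erase j, f k) := by
  rw [Finset.add_sum_erase _ _ (by simp [hij.symm]), Finset.add_sum_erase _ _ (by simp)]

lemma rotLin_apply_i (i j : Fin n) (θ : ℝ) (t : EuclideanSpace ℝ (Fin n)) :
    rotLin i j θ t i = Real.cos θ * t i - Real.sin θ * t j := by
  simp [rotLin]

lemma rotLin_apply_j {i j : Fin n} (hij : i ≠ j) (θ : ℝ) (t : EuclideanSpace ℝ (Fin n)) :
    rotLin i j θ t j = Real.sin θ * t i + Real.cos θ * t j := by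
  simp [rotLin, hij.symm]

lemma rotLin_apply_k {i j k : Fin n} (hi : k ≠ i) (hj : k ≠ j) (θ : ℝ)
    (t : EuclideanSpace ℝ (Fin n)) : rotLin i j θ t k = t k := by
  simp [rotLin, hi, hj]

lemma rotLin_norm {i j : Fin n} (hij : i ≠ j) (θ : ℝ) (t : EuclideanSpace ℝ (Fin n)) :
    ‖rotLin i j θ t‖ = ‖t‖ := by
  rw [EuclideanSpace.norm_eq, EuclideanSpace.norm_eq]
  congr 1
  simp only [Real.norm_eq_abs, sq_abs]
  rw [sum_split hij, sum_split hij, rotLin_apply_i, rotLin_apply_j hij]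
  have : ∑ k ∈ (Finset.univ.erase i).erase j, rotLin i j θ t k ^ 2 =
      ∑ k ∈ (Finset.univ.erase i).erase j, t k ^ 2 := by
    refine Finset.sum_congr rfl fun k hk => ?_
    simp only [Finset.mem_erase] at hk
    rw [rotLin_apply_k hk.2.1 hk.1]
  rw [this]
  linear_combination (t i ^ 2 + t j ^ 2) * Real.sin_sq_add_cos_sq θ

/-- Rotation as a linear isometry equivalence. -/
noncomputable def rotIso {i j : Fin n} (hij : i ≠ j) (θ : ℝ) :
    EuclideanSpace ℝ (Fin n) ≃ₗᵢ[ℝ] EuclideanSpace ℝ (Fin n) :=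
  LinearIsometry.toLinearIsometryEquiv ⟨rotLin i j θ, rotLin_norm hij θ⟩ rfl

lemma rotIso_apply {i j : Fin n} (hij : i ≠ j) (θ : ℝ) (t : EuclideanSpace ℝ (Fin n)) :
    rotIso hij θ t = rotLin i j θ t := rfl

/-- Monomial. -/
noncomputable def mono (g : Fin n → ℕ) (t : EuclideanSpace ℝ (Fin n)) : ℝ := ∏ k, t k ^ g k

lemma mono_cont (g : Fin n → ℕ) : Continuous (mono g) := by
  unfold mono; fun_prop

lemma integrable_cont (σ : Measure (EuclideanSpace ℝ (Fin n))) [IsFiniteMeasure σ]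
    (hs : ∀ᵐ t ∂σ, ‖t‖ = 1) {f : EuclideanSpace ℝ (Fin n) → ℝ} (hf : Continuous f) :
    Integrable f σ := by
  obtain ⟨C, hC⟩ := (isCompact_sphere (0 : EuclideanSpace ℝ (Fin n)) 1).exists_bound_of_continuousOn
    hf.continuousOn
  refine Integrable.of_bound hf.aestronglyMeasurable C ?_
  filter_upwards [hs] with t ht
  exact hC t (by simpa using ht)

lemma integral_isoInv (σ : Measure (EuclideanSpace ℝ (Fin n)))
    (hinv : ∀ e : EuclideanSpace ℝ (Fin n) ≃ₗᵢ[ℝ] EuclideanSpace ℝ (Fin n),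
      MeasurePreserving e σ σ)
    (e : EuclideanSpace ℝ (Fin n) ≃ₗᵢ[ℝ] EuclideanSpace ℝ (Fin n))
    (f : EuclideanSpace ℝ (Fin n) → ℝ) : ∫ t, f (e t) ∂σ = ∫ t, f t ∂σ :=
  (hinv e).integral_comp e.toHomeomorph.measurableEmbedding f

lemma moment_odd (σ : Measure (EuclideanSpace ℝ (Fin n)))
    (hinv : ∀ e : EuclideanSpace ℝ (Fin n) ≃ₗᵢ[ℝ] EuclideanSpace ℝ (Fin n),
      MeasurePreserving e σ σ) (g : Fin n → ℕ) (i : Fin n) (hi : Odd (g i)) :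
    ∫ t, mono g t ∂σ = 0 := by
  have h := integral_isoInv σ hinv (LinearIsometryEquiv.piLpCongrRight 2
    (fun k => if k = i then LinearIsometryEquiv.neg ℝ else LinearIsometryEquiv.refl ℝ ℝ)) (mono g)
  have h2 : ∀ t, mono g ((LinearIsometryEquiv.piLpCongrRight 2
    (fun k => if k = i then LinearIsometryEquiv.neg ℝ else LinearIsometryEquiv.refl ℝ ℝ)) t)
      = - mono g t := by
    intro t
    unfold mono
    rw [← Finset.mul_prod_erase _ _ (Finset.mem_univ i),
      ← Finset.mul_prod_erase _ (fun k => t k ^ g k) (Finset.mem_univ i), ← neg_mul]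
    congr 1
    · simp [LinearIsometryEquiv.piLpCongrRight_apply, hi.neg_pow]
    · refine Finset.prod_congr rfl fun k hk => ?_
      simp only [Finset.mem_erase] at hk
      simp [LinearIsometryEquiv.piLpCongrRight_apply, hk.1]
  simp_rw [h2, integral_neg] at h
  linarith

lemma moment_swap (σ : Measure (EuclideanSpace ℝ (Fin n))) [IsFiniteMeasure σ]
    (hs : ∀ᵐ t ∂σ, ‖t‖ = 1)
    (hinv : ∀ e : EuclideanSpace ℝ (Fin n) ≃ₗᵢ[ℝ] EuclideanSpace ℝ (Fin n),
      MeasurePreserving e σ σ) (g : Fin n → ℕ) (i j : Fin n) :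
    ((g j : ℝ) + 1) * ∫ t, mono (g + Pi.single i 2) t ∂σ =
      ((g i : ℝ) + 1) * ∫ t, mono (g + Pi.single j 2) t ∂σ := by
  rcases eq_or_ne i j with rfl | hij
  · rfl
  set P : EuclideanSpace ℝ (Fin n) → ℝ :=
    fun t => ∏ k ∈ (Finset.univ.erase i).erase j, t k ^ g k with hP
  have hPc : Continuous P := by rw [hP]; fun_prop
  have hPi : ∀ t, mono (g + Pi.single i 2) t = t i ^ (g i + 2) * (t j ^ g j * P t) := by
    intro t
    unfold mono
    rw [prod_split hij]
    simp only [Pi.add_apply, Pi.single_eq_same, Pi.single_eq_of_ne hij.symm, add_zero, hP]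
    congr 2
    refine Finset.prod_congr rfl fun k hk => ?_
    simp only [Finset.mem_erase] at hk
    simp [Pi.single_eq_of_ne hk.2.1]
  have hPj : ∀ t, mono (g + Pi.single j 2) t = t i ^ g i * (t j ^ (g j + 2) * P t) := by
    intro t
    unfold mono
    rw [prod_split hij]
    simp only [Pi.add_apply, Pi.single_eq_same, Pi.single_eq_of_ne hij, add_zero, hP]
    congr 2
    refine Finset.prod_congr rfl fun k hk => ?_
    simp only [Finset.mem_erase] at hk
    simp [Pi.single_eq_of_ne hk.1]
  let F0 : EuclideanSpace ℝ (Fin n) → ℝ := fun t => t i ^ (g i + 1) * t j ^ (g j + 1) * P t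
  let F : ℝ → EuclideanSpace ℝ (Fin n) → ℝ := fun θ t =>
    (Real.cos θ * t i - Real.sin θ * t j) ^ (g i + 1) *
      (Real.sin θ * t i + Real.cos θ * t j) ^ (g j + 1) * P t
  let F' : ℝ → EuclideanSpace ℝ (Fin n) → ℝ := fun θ t =>
    ((((g i + 1 : ℕ) : ℝ) * (Real.cos θ * t i - Real.sin θ * t j) ^ (g i) *
        (-Real.sin θ * t i - Real.cos θ * t j)) *
      (Real.sin θ * t i + Real.cos θ * t j) ^ (g j + 1) +
      (Real.cos θ * t i - Real.sin θ * t j) ^ (g i + 1) *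
      (((g j + 1 : ℕ) : ℝ) * (Real.sin θ * t i + Real.cos θ * t j) ^ (g j) *
        (Real.cos θ * t i + -Real.sin θ * t j))) * P t
  have hFF : ∀ θ t, F θ t = F0 (rotIso hij θ t) := by
    intro θ t
    simp only [F, F0, rotIso_apply, rotLin_apply_i, rotLin_apply_j hij]
    congr 1
    refine Finset.prod_congr rfl fun k hk => ?_
    simp only [Finset.mem_erase] at hk
    rw [rotLin_apply_k hk.2.1 hk.1]
  have hconst : ∀ θ, ∫ t, F θ t ∂σ = ∫ t, F0 t ∂σ := by
    intro θ
    simp_rw [hFF]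
    exact integral_isoInv σ hinv (rotIso hij θ) F0
  have hF'c : Continuous (fun q : ℝ × EuclideanSpace ℝ (Fin n) => F' q.1 q.2) := by
    simp only [F']; fun_prop
  have hFc : ∀ θ, Continuous (F θ) := by
    intro θ; simp only [F]; fun_prop
  have hdiff : ∀ t θ, HasDerivAt (F · t) (F' θ t) θ := by
    intro t θ
    have h1 : HasDerivAt (fun θ => Real.cos θ * t i - Real.sin θ * t j)
        (-Real.sin θ * t i - Real.cos θ * t j) θ :=
      ((Real.hasDerivAt_cos θ).mul_const _).sub ((Real.hasDerivAt_sin θ).mul_const _)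
    have h2 : HasDerivAt (fun θ => Real.sin θ * t i + Real.cos θ * t j)
        (Real.cos θ * t i + -Real.sin θ * t j) θ :=
      ((Real.hasDerivAt_sin θ).mul_const _).add ((Real.hasDerivAt_cos θ).mul_const _)
    exact ((h1.pow (g i + 1)).mul (h2.pow (g j + 1))).mul_const (P t)
  obtain ⟨C, hC⟩ := ((isCompact_Icc (a := (-1 : ℝ)) (b := 1)).prod
    (isCompact_sphere (0 : EuclideanSpace ℝ (Fin n)) 1)).exists_bound_of_continuousOn
    hF'c.continuousOn
  have key := hasDerivAt_integral_of_dominated_loc_of_deriv_le (μ := σ) (F := F) (F' := F')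
    (x₀ := 0) (s := Set.Icc (-1) 1) (bound := fun _ => C)
    (Icc_mem_nhds (by norm_num) (by norm_num))
    (Filter.Eventually.of_forall fun θ => (hFc θ).aestronglyMeasurable)
    (integrable_cont σ hs (hFc 0))
    (hF'c.comp (Continuous.prodMk_right (0 : ℝ))).aestronglyMeasurable
    (by
      filter_upwards [hs] with t ht θ hθ
      exact hC (θ, t) ⟨hθ, by simpa using ht⟩)
    (integrable_const C)
    (Filter.Eventually.of_forall fun t θ _ => hdiff t θ)
  have h0 := key.2
  simp_rw [hconst] at h0
  have h00 : ∫ t, F' 0 t ∂σ = 0 := h0.unique (hasDerivAt_const _ _)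
  have hF'0 : ∀ t, F' 0 t = ((g j : ℝ) + 1) * mono (g + Pi.single i 2) t -
      ((g i : ℝ) + 1) * mono (g + Pi.single j 2) t := by
    intro t
    rw [hPi, hPj]
    simp only [F', Real.cos_zero, Real.sin_zero]
    push_cast
    ring
  simp_rw [hF'0] at h00
  rw [integral_sub ((integrable_cont σ hs (mono_cont _)).const_mul _)
    ((integrable_cont σ hs (mono_cont _)).const_mul _), integral_const_mul,
    integral_const_mul] at h00
  linarith

lemma moment_rec (σ : Measure (EuclideanSpace ℝ (Fin n))) [IsFiniteMeasure σ]
    (hs : ∀ᵐ t ∂σ, ‖t‖ = 1)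
    (hinv : ∀ e : EuclideanSpace ℝ (Fin n) ≃ₗᵢ[ℝ] EuclideanSpace ℝ (Fin n),
      MeasurePreserving e σ σ) (g : Fin n → ℕ) (i : Fin n) :
    ((n : ℝ) + ((∑ k, g k : ℕ) : ℝ)) * ∫ t, mono (g + Pi.single i 2) t ∂σ =
      ((g i : ℝ) + 1) * ∫ t, mono g t ∂σ := by
  have h1 : ∫ t, mono g t ∂σ = ∑ j, ∫ t, mono (g + Pi.single j 2) t ∂σ := by
    rw [← integral_finsetSum _ fun j _ => integrable_cont σ hs (mono_cont _)]
    refine integral_congr_ae ?_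
    filter_upwards [hs] with t ht
    have h2 : ∑ k, t k ^ 2 = 1 := by
      have := EuclideanSpace.norm_sq_eq t
      rw [ht] at this
      simpa using this.symm
    have h3 : ∀ j, mono (g + Pi.single j 2) t = mono g t * t j ^ 2 := by
      intro j
      unfold mono
      simp only [Pi.add_apply, pow_add, Finset.prod_mul_distrib]
      congr 1
      rw [Finset.prod_eq_single j]
      · simp
      · intro b _ hb
        simp [Pi.single_eq_of_ne hb]
      · simp
    simp_rw [h3, ← Finset.mul_sum, h2, mul_one]
  rw [h1, Finset.mul_sum]
  simp_rw [← moment_swap σ hs hinv g i]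
  rw [← Finset.sum_mul]
  congr 1
  rw [Finset.sum_add_distrib]
  simp
  ring

end Rot

lemma moment_even (e : ℕ) (σ : Measure (EuclideanSpace ℝ (Fin (e + 2)))) [IsFiniteMeasure σ]
    (hs : ∀ᵐ t ∂σ, ‖t‖ = 1)
    (hinv : ∀ L : EuclideanSpace ℝ (Fin (e + 2)) ≃ₗᵢ[ℝ] EuclideanSpace ℝ (Fin (e + 2)),
      MeasurePreserving L σ σ) (m : ℕ) : ∀ g : Fin (e + 2) → ℕ, ∑ i, g i = m →
    ∫ t, mono (fun i => 2 * g i) t ∂σ = σ.real Set.univ *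
      (((Nat.doubleFactorial e : ℝ) * ∏ i, (Nat.doubleFactorial (2 * g i - 1) : ℝ)) /
        (Nat.doubleFactorial (e + 2 * m) : ℝ)) := by
  have hdf : ∀ k : ℕ, (Nat.doubleFactorial k : ℝ) ≠ 0 := fun k => by
    exact_mod_cast (Nat.doubleFactorial_pos k).ne'
  induction m with
  | zero =>
    intro g hg
    have hg0 : ∀ i, g i = 0 := by simpa using hg
    simp [mono, hg0, hdf]
  | succ m ih =>
    intro g hg
    obtain ⟨i, hi⟩ : ∃ i, g i ≠ 0 := by
      by_contra! h
      simp [h] at hg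
    obtain ⟨g', rfl⟩ : ∃ g' : Fin (e + 2) → ℕ, g = g' + Pi.single i 1 := by
      refine ⟨g - Pi.single i 1, ?_⟩
      ext k
      rcases eq_or_ne k i with rfl | hk
      · simp; omega
      · simp [Pi.single_eq_of_ne hk]
    have hg' : ∑ k, g' k = m := by
      simpa [Finset.sum_add_distrib] using hg
    have hr := moment_rec σ hs hinv (fun k => 2 * g' k) i
    have he : (fun k => 2 * (g' + Pi.single i 1 : Fin (e + 2) → ℕ) k) = (fun k => 2 * g' k) + Pi.single i 2 := by
      ext k
      rcases eq_or_ne k i with rfl | hk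
      · simp; ring
      · simp [Pi.single_eq_of_ne hk]
    rw [he]
    rw [ih g' hg', ← Finset.mul_sum, hg'] at hr
    have hp : ∏ k, (Nat.doubleFactorial (2 * (g' + Pi.single i 1 : Fin (e + 2) → ℕ) k - 1) : ℝ) =
        (2 * g' i + 1) * ∏ k, (Nat.doubleFactorial (2 * g' k - 1) : ℝ) := by
      rw [← Finset.mul_prod_erase _ _ (Finset.mem_univ i),
        ← Finset.mul_prod_erase _ (fun k => (Nat.doubleFactorial (2 * g' k - 1) : ℝ))
          (Finset.mem_univ i), ← mul_assoc]
      congr 1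
      · simp only [Pi.add_apply, Pi.single_eq_same]
        rcases g' i with _ | a
        · simp
        · rw [show 2 * (a + 1 + 1) - 1 = 2 * a + 1 + 2 by omega,
            show 2 * (a + 1) - 1 = 2 * a + 1 by omega, Nat.doubleFactorial_add_two]
          push_cast
          ring
      · refine Finset.prod_congr rfl fun k hk => ?_
        simp only [Finset.mem_erase] at hk
        simp [Pi.single_eq_of_ne hk.1]
    rw [hp, show e + 2 * (m + 1) = e + 2 * m + 2 by ring, Nat.doubleFactorial_add_two]
    have hpos : ((e : ℝ) + 2 * m + 2) ≠ 0 := by positivity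
    have h3 := hdf (e + 2 * m)
    push_cast at hr ⊢
    rw [mul_comm] at hr
    have hr' := eq_div_of_mul_eq (by positivity) hr
    rw [hr']
    field_simp
    ring

lemma series_aux (e : ℕ) (σ : Measure (EuclideanSpace ℝ (Fin (e + 2)))) [IsFiniteMeasure σ]
    (hs : ∀ᵐ t ∂σ, ‖t‖ = 1)
    (hinv : ∀ L : EuclideanSpace ℝ (Fin (e + 2)) ≃ₗᵢ[ℝ] EuclideanSpace ℝ (Fin (e + 2)),
      MeasurePreserving L σ σ) (x y : Fin (e + 2) → ℝ) :
    ∫ t, Real.exp (∑ i, (x i * t i ^ 2 + y i * t i)) ∂σ =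
      ∑' p : (Fin (e + 2) → ℕ) × (Fin (e + 2) → ℕ),
        (∏ i, (x i ^ p.1 i / (Nat.factorial (p.1 i) : ℝ))) *
        (∏ i, (y i ^ p.2 i / (Nat.factorial (p.2 i) : ℝ))) *
        ∫ t, mono (fun i => 2 * p.1 i + p.2 i) t ∂σ := by
  have hterm : ∀ (p : (Fin (e + 2) → ℕ) × (Fin (e + 2) → ℕ)) (t : EuclideanSpace ℝ (Fin (e + 2))),
      (∏ i, ((x i * t i ^ 2) ^ p.1 i / (Nat.factorial (p.1 i) : ℝ))) *
        (∏ i, ((y i * t i) ^ p.2 i / (Nat.factorial (p.2 i) : ℝ))) =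
      (∏ i, (x i ^ p.1 i / (Nat.factorial (p.1 i) : ℝ))) *
        (∏ i, (y i ^ p.2 i / (Nat.factorial (p.2 i) : ℝ))) *
        mono (fun i => 2 * p.1 i + p.2 i) t := by
    intro p t
    unfold mono
    simp only [← Finset.prod_mul_distrib]
    refine Finset.prod_congr rfl fun i _ => ?_
    rw [mul_pow, mul_pow, pow_add, pow_mul]
    ring
  have hb : ∀ (g : Fin (e + 2) → ℕ) (t : EuclideanSpace ℝ (Fin (e + 2))), ‖t‖ = 1 →
      |mono g t| ≤ 1 := by
    intro g t ht
    unfold mono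
    rw [Finset.abs_prod]
    refine Finset.prod_le_one (fun i _ => abs_nonneg _) fun i _ => ?_
    rw [abs_pow]
    refine pow_le_one₀ (abs_nonneg _) ?_
    have := PiLp.norm_apply_le t i
    rwa [ht] at this
  have hsum := summable_mul_of_summable_norm (exp_pi_series (e + 2) x).1 (exp_pi_series (e + 2) y).1
  have key := hasSum_integral_of_dominated_convergence (μ := σ)
    (F := fun (p : (Fin (e + 2) → ℕ) × (Fin (e + 2) → ℕ)) t =>
      (∏ i, (x i ^ p.1 i / (Nat.factorial (p.1 i) : ℝ))) *
        (∏ i, (y i ^ p.2 i / (Nat.factorial (p.2 i) : ℝ))) *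
        mono (fun i => 2 * p.1 i + p.2 i) t)
    (f := fun t => Real.exp (∑ i, (x i * t i ^ 2 + y i * t i)))
    (fun p _ => ‖(∏ i, (x i ^ p.1 i / (Nat.factorial (p.1 i) : ℝ))) *
        (∏ i, (y i ^ p.2 i / (Nat.factorial (p.2 i) : ℝ)))‖)
    (fun p => ((mono_cont _).const_mul _).aestronglyMeasurable)
    (fun p => by
      filter_upwards [hs] with t ht
      rw [norm_mul]
      exact mul_le_of_le_one_right (norm_nonneg _) (hb _ t ht))
    (Filter.Eventually.of_forall fun _ => hsum.norm)
    (integrable_const _)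
    (Filter.Eventually.of_forall fun t => by
      simp_rw [← hterm]
      exact exp_pi_series2 (e + 2) (fun i => x i * t i ^ 2) (fun i => y i * t i))
  rw [← key.tsum_eq]
  simp_rw [integral_const_mul]

theorem Ztilde_series_expansion (d : ℕ) (hd : 1 ≤ d) (x y : Fin (d + 1) → ℝ) :
    Ztilde d x y 1 =
      sphereArea d *
        ∑' p : (Fin (d + 1) → ℕ) × (Fin (d + 1) → ℕ),
          (((Nat.doubleFactorial (d - 1) : ℝ) *
                ∏ i, (Nat.doubleFactorial (2 * p.1 i + 2 * p.2 i - 1) : ℝ)) /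
              ((Nat.doubleFactorial (d - 1 + 2 * (∑ i, p.1 i) + 2 * (∑ i, p.2 i)) : ℝ) *
                (∏ i, (Nat.factorial (p.1 i) : ℝ)) *
                ∏ i, (Nat.factorial (2 * p.2 i) : ℝ))) *
            (∏ i, x i ^ p.1 i) * ∏ i, y i ^ (2 * p.2 i) := by
  obtain ⟨e, rfl⟩ : ∃ e, d = e + 1 := ⟨d - 1, by omega⟩
  simp only [Nat.add_sub_cancel]
  set S := Metric.sphere (0 : EuclideanSpace ℝ (Fin (e + 1 + 1))) 1 with hS
  have hSm : MeasurableSet S := Metric.isClosed_sphere.measurableSet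
  set σ : Measure (EuclideanSpace ℝ (Fin (e + 1 + 1))) := (μH[((e + 1 : ℕ) : ℝ)]).restrict S with hσ
  have hZ : Ztilde (e + 1) x y 1 = ∫ t, Real.exp (∑ i, (x i * t i ^ 2 + y i * t i)) ∂σ := rfl
  have hA : sphereArea (e + 1) = σ.real Set.univ := by
    rw [sphereArea, Measure.real, hσ, Measure.restrict_apply_univ]
  have hs : ∀ᵐ t ∂σ, ‖t‖ = 1 := by
    filter_upwards [ae_restrict_mem hSm] with t ht
    simpa [hS] using ht
  have hinv : ∀ L : EuclideanSpace ℝ (Fin (e + 2)) ≃ₗᵢ[ℝ] EuclideanSpace ℝ (Fin (e + 2)),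
      MeasurePreserving L σ σ := by
    intro L
    have h := (L.toIsometryEquiv.measurePreserving_hausdorffMeasure
      ((e + 1 : ℕ) : ℝ)).restrict_preimage hSm
    have hpre : L.toIsometryEquiv ⁻¹' S = S := by
      ext t
      simp [hS]
    rw [hpre] at h
    exact h
  by_cases hfin : σ Set.univ = ⊤
  · have h0 : sphereArea (e + 1) = 0 := by rw [hA, Measure.real, hfin]; rfl
    rw [h0, zero_mul, hZ]
    refine integral_undef fun hint => ?_
    have hc : Continuous fun t : EuclideanSpace ℝ (Fin (e + 2)) =>
        Real.exp (-∑ i, (x i * t i ^ 2 + y i * t i)) := by fun_prop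
    obtain ⟨C, hC⟩ := (isCompact_sphere (0 : EuclideanSpace ℝ (Fin (e + 2))) 1).exists_bound_of_continuousOn
      hc.continuousOn
    have h1 : Integrable (fun _ => (1 : ℝ)) σ := by
      refine (hint.const_mul C).mono' aestronglyMeasurable_const ?_
      filter_upwards [hs] with t ht
      have := hC t (by simpa using ht)
      rw [Real.norm_eq_abs, Real.abs_exp, Real.exp_neg, inv_le_iff_one_le_mul₀ (Real.exp_pos _)] at this
      simpa using this
    rw [integrable_const_iff] at h1
    rcases h1 with h1 | h1
    · norm_num at h1
    · exact (h1.measure_univ_lt_top).ne hfin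
  · have : IsFiniteMeasure σ := ⟨lt_top_iff_ne_top.2 hfin⟩
    rw [hZ, hA, series_aux e σ hs hinv x y, ← tsum_mul_left]
    have hinj : Function.Injective
        (fun p : (Fin (e + 2) → ℕ) × (Fin (e + 2) → ℕ) => (p.1, fun i => 2 * p.2 i)) := by
      rintro ⟨a, b⟩ ⟨a', b'⟩ h
      simp only [Prod.mk.injEq] at h
      refine Prod.ext h.1 (funext fun i => ?_)
      have := congrFun h.2 i
      simpa using this
    rw [← hinj.tsum_eq]
    · refine tsum_congr fun p => ?_
      have hm := moment_even e σ hs hinv (∑ i, (p.1 i + p.2 i)) (fun i => p.1 i + p.2 i) rfl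
      simp only [mul_add] at hm
      simp only []
      rw [hm, Finset.sum_add_distrib, mul_add, ← add_assoc, Finset.prod_div_distrib,
        Finset.prod_div_distrib]
      simp only [div_eq_mul_inv, mul_inv]
      ring
    · intro p hp
      by_contra hr
      apply hp
      have : ∃ i, Odd (p.2 i) := by
        by_contra! h
        refine hr ⟨(p.1, fun i => p.2 i / 2), Prod.ext rfl (funext fun i => ?_)⟩
        have := Nat.not_odd_iff_even.1 (h i)
        exact Nat.two_mul_div_two_of_even this
      obtain ⟨i, hi⟩ := this
      have h0 := moment_odd (n := e + 2) σ hinv (fun i => 2 * p.1 i + p.2 i) i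
        ((even_two_mul _).add_odd hi)
      simp only [h0, mul_zero]
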